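/- Let S : ℝ → ℝ be infinitely differentiable with (deriv (deriv S)) x ≠ 0 for all x ∈ ℝ, and let x̃ : ℝ → ℝ be infinitely differentiable and satisfy (deriv S) (x̃ p) = p for all p ∈ ℝ. Define the Legendre transform S̃ p := −p · (x̃ p) + S (x̃ p), define u : ℝ → ℝ by u x := 1 / (deriv (deriv S)) x, and define v : ℕ → (ℝ → ℝ) recursively by v 0 := u and v (m+1) := fun x => u x · (deriv (v m)) x. Then for every m ∈ ℕ and every p ∈ ℝ, iteratedDeriv (m + 2) S̃ p = − (v m) (x̃ p); that is, the (m+2)-nd derivative of the Legendre transform is given by ∂^{m+2} S̃ / ∂p^{m+2} = −((u · d/dx)^m u)(x̃(p)). -/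

import Mathlib

/-- `legendreV u m` is `(u · d/dx)^m u`. -/
noncomputable def legendreV (u : ℝ → ℝ) : ℕ → ℝ → ℝ
  | 0 => u
  | m + 1 => fun x => u x * deriv (legendreV u m) x

theorem contDiff_legendreV {u : ℝ → ℝ} (hu : ContDiff ℝ (⊤ : ℕ∞) u) (m : ℕ) :
    ContDiff ℝ (⊤ : ℕ∞) (legendreV u m) := by
  induction m with
  | zero => exact hu
  | succ m ih => exact hu.mul (contDiff_infty_iff_deriv.1 ih).2

/-- If `x' = u ∘ x`, differentiating along `x` acts as `u · d/dx`. -/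
theorem iteratedDeriv_eq_legendreV_comp {u x : ℝ → ℝ} (hu : ContDiff ℝ (⊤ : ℕ∞) u)
    (hx : ∀ p, HasDerivAt x (u (x p)) p) (m : ℕ) :
    iteratedDeriv (m + 1) x = legendreV u m ∘ x := by
  induction m with
  | zero =>
    ext p
    simpa [legendreV, iteratedDeriv_one] using (hx p).deriv
  | succ m ih =>
    ext p
    have hv := ((contDiff_legendreV hu m).differentiable (by simp) (x p)).hasDerivAt
    rw [iteratedDeriv_succ, ih, (hv.comp p (hx p)).deriv, mul_comm]
    rfl

/-- The derivative of an inverse of `S'` is `1 / S''`. -/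
theorem hasDerivAt_of_deriv_comp_eq_id {S x : ℝ → ℝ} {p : ℝ}
    (hS : DifferentiableAt ℝ (deriv S) (x p))
    (hx : DifferentiableAt ℝ x p) (hcrit : ∀ p, deriv S (x p) = p) :
    HasDerivAt x (1 / deriv (deriv S) (x p)) p := by
  have h := hS.hasDerivAt.comp p hx.hasDerivAt
  rw [show deriv S ∘ x = id from funext hcrit] at h
  rw [one_div, ← eq_inv_of_mul_eq_one_right (h.unique (hasDerivAt_id p))]
  exact hx.hasDerivAt

/-- The first derivative of the Legendre transform is minus the critical point. -/
theorem hasDerivAt_legendre {S x : ℝ → ℝ} {p : ℝ}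
    (hS : DifferentiableAt ℝ S (x p)) (hx : DifferentiableAt ℝ x p)
    (hcrit : deriv S (x p) = p) :
    HasDerivAt (fun p => -p * x p + S (x p)) (-x p) p := by
  have h := ((hasDerivAt_id p).neg.mul hx.hasDerivAt).add
    (hS.hasDerivAt.comp p hx.hasDerivAt)
  rw [hcrit] at h
  refine h.congr_deriv ?_
  simp

/-- Higher derivatives of the Legendre transform `S̃ p = -p * xt p + S (xt p)`:
with `u x := 1 / S'' x`, for every `m`,
`∂^{m+2} S̃ / ∂p^{m+2} = -((u · d/dx)^m u)(xt p)`. -/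
theorem legendre_higher_derivs (S xt : ℝ → ℝ)
    (hS : ContDiff ℝ (⊤ : ℕ∞) S) (hne : ∀ x, deriv (deriv S) x ≠ 0)
    (hx : ContDiff ℝ (⊤ : ℕ∞) xt)
    (hcrit : ∀ p, deriv S (xt p) = p)
    (m : ℕ) (p : ℝ) :
    iteratedDeriv (m + 2) (fun p => -p * xt p + S (xt p)) p
      = -legendreV (fun x => 1 / deriv (deriv S) x) m (xt p) := by
  have hS' := (contDiff_infty_iff_deriv.1 hS).2
  have hu : ContDiff ℝ (⊤ : ℕ∞) fun x => 1 / deriv (deriv S) x :=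
    contDiff_const.div (contDiff_infty_iff_deriv.1 hS').2 hne
  have hL : deriv (fun p => -p * xt p + S (xt p)) = -xt := funext fun p =>
    (hasDerivAt_legendre (hS.differentiable (by simp) _) (hx.differentiable (by simp) _)
      (hcrit p)).deriv
  have hxt (p : ℝ) : HasDerivAt xt (1 / deriv (deriv S) (xt p)) p :=
    hasDerivAt_of_deriv_comp_eq_id (hS'.differentiable (by simp) _)
      (hx.differentiable (by simp) _) hcrit
  rw [iteratedDeriv_succ', hL, iteratedDeriv_neg, iteratedDeriv_eq_legendreV_comp hu hxt]
  rfl
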